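/- arXiv:2404.11173 — 2 statements merged into one kernel-verified Lean document; each statement's English description precedes it below -/
import Mathlib

section
/- For natural numbers n and m with n ≠ m, the integral ∫₀¹ Pₙ(2x−1)·Pₘ(2x−1)·log(x) dx equals (−1)^(n+m+1) / (|n−m|·(n+m+1)). -/
open MeasureTheory Real

/-- The Legendre polynomials, defined by `P 0 x = 1`, `P 1 x = x` and the
three-term recurrence `(n+1) * P (n+1) x = (2*n+1) * x * P n x - n * P (n-1) x` for `n ≥ 1`. -/
noncomputable def legendreP : ℕ → ℝ → ℝ
  | 0, _ => 1
  | 1, x => x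
  | (n + 2), x =>
      ((2 * (n + 1 : ℝ) + 1) * x * legendreP (n + 1) x - (n + 1 : ℝ) * legendreP n x)
        / ((n + 1 : ℝ) + 1)

/-- `N n m = ∫₀¹ Pₙ(2x-1) Pₘ(2x-1) log x dx`. -/
noncomputable def N (n m : ℕ) : ℝ :=
  ∫ x in (0:ℝ)..1, legendreP n (2 * x - 1) * legendreP m (2 * x - 1) * Real.log x

open Polynomial

/-- The shifted Legendre polynomial, representing `x ↦ legendreP n (2 * x - 1)`. -/
noncomputable def shiftedLegendreP : ℕ → ℝ[X]
  | 0 => 1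
  | 1 => 2 * X - 1
  | (n + 2) =>
      C ((n : ℝ) + 2)⁻¹ * ((2 * (n : ℝ[X]) + 3) * (2 * X - 1) * shiftedLegendreP (n + 1)
        - ((n : ℝ[X]) + 1) * shiftedLegendreP n)

theorem shiftedLegendreP_recurrence (n : ℕ) :
    ((n : ℝ[X]) + 2) * shiftedLegendreP (n + 2) =
      (2 * (n : ℝ[X]) + 3) * (2 * X - 1) * shiftedLegendreP (n + 1)
        - ((n : ℝ[X]) + 1) * shiftedLegendreP n := by
  have hC : ((n : ℝ[X]) + 2) = C ((n : ℝ) + 2) := by simp [map_ofNat C 2]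
  have h0 : (n : ℝ) + 2 ≠ 0 := by positivity
  rw [shiftedLegendreP, ← mul_assoc, hC, ← C_mul, mul_inv_cancel₀ h0, C_1, one_mul]

theorem eval_shiftedLegendreP (n : ℕ) (x : ℝ) :
    (shiftedLegendreP n).eval x = legendreP n (2 * x - 1) := by
  induction n using Nat.twoStepInduction with
  | zero => simp [shiftedLegendreP, legendreP]
  | one => simp [shiftedLegendreP, legendreP]
  | more n ih₀ ih₁ =>
    have h0 : (n : ℝ) + 2 ≠ 0 := by positivity
    have h := congrArg (eval x) (shiftedLegendreP_recurrence n)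
    simp only [eval_mul, eval_add, eval_sub, eval_natCast, eval_ofNat, eval_X, eval_one,
      ih₀, ih₁] at h
    rw [legendreP, eq_div_iff (by positivity)]
    linear_combination h

theorem eval_zero_shiftedLegendreP (n : ℕ) : (shiftedLegendreP n).eval 0 = (-1) ^ n := by
  induction n using Nat.twoStepInduction with
  | zero => simp [shiftedLegendreP]
  | one => simp [shiftedLegendreP]
  | more n ih₀ ih₁ =>
    have h0 : (n : ℝ) + 2 ≠ 0 := by positivity
    have h := congrArg (eval 0) (shiftedLegendreP_recurrence n)
    simp only [eval_mul, eval_add, eval_sub, eval_natCast, eval_ofNat, eval_X, eval_one,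
      ih₀, ih₁] at h
    apply mul_left_cancel₀ h0
    rw [h]
    ring

theorem natDegree_shiftedLegendreP_le (n : ℕ) : (shiftedLegendreP n).natDegree ≤ n := by
  induction n using Nat.twoStepInduction with
  | zero => simp [shiftedLegendreP]
  | one =>
    rw [shiftedLegendreP]
    compute_degree
  | more n ih₀ ih₁ =>
    rw [shiftedLegendreP]
    refine (natDegree_C_mul_le _ _).trans ((natDegree_sub_le _ _).trans (max_le ?_ ?_))
    · have h1 : ((2 * (n : ℝ[X]) + 3) * (2 * X - 1)).natDegree ≤ 1 := by compute_degree
      exact natDegree_mul_le.trans (by omega)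
    · have h1 : ((n : ℝ[X]) + 1).natDegree ≤ 0 := by compute_degree
      exact natDegree_mul_le.trans (by omega)

theorem derivative_shiftedLegendreP_succ (n : ℕ) :
    derivative (shiftedLegendreP (n + 1)) = (2 * X - 1) * derivative (shiftedLegendreP n)
        + 2 * ((n : ℝ[X]) + 1) * shiftedLegendreP n ∧
    (2 * X - 1) * derivative (shiftedLegendreP (n + 1)) = derivative (shiftedLegendreP n)
        + 2 * ((n : ℝ[X]) + 1) * shiftedLegendreP (n + 1) := by
  induction n with
  | zero => simp [shiftedLegendreP, mul_comm]
  | succ n ih =>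
    obtain ⟨ih₁, ih₂⟩ := ih
    have hrec := shiftedLegendreP_recurrence n
    have hder := congrArg derivative hrec
    simp only [derivative_mul, derivative_add, derivative_sub, derivative_natCast,
      derivative_ofNat, derivative_X, derivative_one] at hder
    have h0 : (n : ℝ[X]) + 2 ≠ 0 := by exact_mod_cast (by omega : n + 2 ≠ 0)
    have hA : derivative (shiftedLegendreP (n + 2)) =
        (2 * X - 1) * derivative (shiftedLegendreP (n + 1))
          + 2 * ((n : ℝ[X]) + 2) * shiftedLegendreP (n + 1) := by
      apply mul_left_cancel₀ h0
      linear_combination hder + ((n : ℝ[X]) + 1) * ih₂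
    push_cast
    refine ⟨by linear_combination hA, ?_⟩
    linear_combination (2 * X - 1) * hA + (2 * X - 1) * ih₂ - ih₁ - 2 * hrec

/-- The Legendre differential equation on `[0, 1]`. -/
theorem derivative_mul_derivative_shiftedLegendreP (n : ℕ) :
    derivative (X * (X - 1) * derivative (shiftedLegendreP n)) =
      (n : ℝ[X]) * ((n : ℝ[X]) + 1) * shiftedLegendreP n := by
  cases n with
  | zero => simp [shiftedLegendreP]
  | succ n =>
    obtain ⟨h₁, h₂⟩ := derivative_shiftedLegendreP_succ n
    have h : 2 * (X * (X - 1) * derivative (shiftedLegendreP (n + 1))) =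
        ((n : ℝ[X]) + 1) * ((2 * X - 1) * shiftedLegendreP (n + 1) - shiftedLegendreP n) := by
      apply mul_left_cancel₀ (two_ne_zero : (2 : ℝ[X]) ≠ 0)
      linear_combination (2 * X - 1) * h₂ - h₁
    have hprod : derivative ((2 * X - 1) * shiftedLegendreP (n + 1)) =
        2 * shiftedLegendreP (n + 1) + (2 * X - 1) * derivative (shiftedLegendreP (n + 1)) := by
      simp
    have hder := congrArg derivative h
    rw [derivative_mul (f := 2), derivative_mul (f := (n : ℝ[X]) + 1)] at hder
    simp only [derivative_ofNat, derivative_add, derivative_natCast, derivative_one, zero_mul,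
      add_zero, zero_add, derivative_sub (f := (2 * X - 1) * shiftedLegendreP (n + 1)),
      hprod] at hder
    apply mul_left_cancel₀ (two_ne_zero : (2 : ℝ[X]) ≠ 0)
    push_cast
    linear_combination hder + ((n : ℝ[X]) + 1) * h₂

/-- Integration of polynomials over `[0, 1]` as a linear functional. -/
noncomputable def unitIntegral : ℝ[X] →ₗ[ℝ] ℝ where
  toFun f := ∫ x in (0 : ℝ)..1, f.eval x
  map_add' f g := by
    simp only [eval_add]
    exact intervalIntegral.integral_add (f.continuous.intervalIntegrable _ _)
      (g.continuous.intervalIntegrable _ _)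
  map_smul' c f := by simp

theorem unitIntegral_derivative (f : ℝ[X]) :
    unitIntegral (derivative f) = f.eval 1 - f.eval 0 :=
  intervalIntegral.integral_eq_sub_of_hasDerivAt (fun x _ => f.hasDerivAt x)
    ((derivative f).continuous.intervalIntegrable _ _)

theorem unitIntegral_C_mul (c : ℝ) (f : ℝ[X]) : unitIntegral (C c * f) = c * unitIntegral f := by
  rw [← smul_eq_C_mul, map_smul, smul_eq_mul]

theorem unitIntegral_X_pow_mul_shiftedLegendreP {k m : ℕ} (h : k < m) :
    unitIntegral (X ^ k * shiftedLegendreP m) = 0 := by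
  set q := shiftedLegendreP m with hq
  have hode : derivative (X * (X - 1) * derivative q) = _ :=
    derivative_mul_derivative_shiftedLegendreP m
  rw [← hq] at hode
  have hne : ((m : ℝ) * (m + 1) - k * (k + 1)) ≠ 0 := by
    have : (k : ℝ) < m := by exact_mod_cast h
    have hk : (0 : ℝ) ≤ k := by positivity
    nlinarith
  apply mul_left_cancel₀ hne
  rw [mul_zero, ← unitIntegral_C_mul]
  cases k with
  | zero =>
    have : C ((m : ℝ) * (m + 1) - (0 : ℕ) * ((0 : ℕ) + 1)) * (X ^ 0 * q) =
        derivative (X * (X - 1) * derivative q) := by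
      rw [hode]; simp
    rw [this, unitIntegral_derivative]
    simp
  | succ k =>
    have ih := unitIntegral_X_pow_mul_shiftedLegendreP (k := k) (m := m) (by omega)
    rw [← hq] at ih
    have : C ((m : ℝ) * (m + 1) - (k + 1 : ℕ) * ((k + 1 : ℕ) + 1)) * (X ^ (k + 1) * q) =
        derivative (X ^ (k + 1) * (X * (X - 1) * derivative q)
          - ((k : ℝ[X]) + 1) * X ^ (k + 1) * (X - 1) * q)
          + C (-((k : ℝ) + 1) ^ 2) * (X ^ k * q) := by
      rw [derivative_sub, derivative_mul (f := X ^ (k + 1)), hode]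
      simp
      ring
    rw [this, map_add, unitIntegral_C_mul, ih, unitIntegral_derivative]
    simp

theorem unitIntegral_mul_shiftedLegendreP {f : ℝ[X]} {m : ℕ} (h : f.natDegree < m) :
    unitIntegral (f * shiftedLegendreP m) = 0 := by
  rw [f.as_sum_range_C_mul_X_pow, Finset.sum_mul, map_sum]
  refine Finset.sum_eq_zero fun i hi => ?_
  rw [mul_assoc, unitIntegral_C_mul, unitIntegral_X_pow_mul_shiftedLegendreP, mul_zero]
  have := Finset.mem_range.mp hi
  omega

/-- Integration by parts against the logarithm. -/
theorem integral_derivative_X_mul_mul_log (f : ℝ[X]) :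
    ∫ x in (0 : ℝ)..1, (derivative (X * f)).eval x * Real.log x = -unitIntegral f := by
  have hlog : IntervalIntegrable (fun x => (derivative (X * f)).eval x * Real.log x)
      volume 0 1 :=
    intervalIntegral.intervalIntegrable_log'.continuousOn_mul
      (derivative (X * f)).continuous.continuousOn
  have hf : IntervalIntegrable (fun x => f.eval x) volume 0 1 :=
    f.continuous.intervalIntegrable _ _
  have key := intervalIntegral.integral_eq_sub_of_hasDerivAt_of_le (zero_le_one' ℝ)
    (f := fun x => f.eval x * (x * Real.log x))
    (f' := fun x => (derivative (X * f)).eval x * Real.log x + f.eval x)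
    (f.continuous.mul Real.continuous_mul_log).continuousOn
    (fun x hx => by
      have hx0 : x ≠ 0 := hx.1.ne'
      refine ((f.hasDerivAt x).mul
        ((hasDerivAt_id x).mul (Real.hasDerivAt_log hx0))).congr_deriv ?_
      simp
      field_simp
      ring)
    (hlog.add hf)
  rw [intervalIntegral.integral_add hlog hf] at key
  simp only [Real.log_one, mul_zero, zero_mul, sub_self] at key
  exact eq_neg_of_add_eq_zero_left key

theorem unitIntegral_wronskian_shiftedLegendreP {n m : ℕ} (h : n < m) :
    unitIntegral ((1 - X) * (derivative (shiftedLegendreP n) * shiftedLegendreP m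
      - shiftedLegendreP n * derivative (shiftedLegendreP m))) = (-1) ^ (n + m) := by
  have hdeg : (2 * (1 - X) * derivative (shiftedLegendreP n)
      - shiftedLegendreP n).natDegree < m := by
    have h0 := natDegree_shiftedLegendreP_le n
    refine lt_of_le_of_lt ((natDegree_sub_le _ _).trans (max_le ?_ h0)) h
    cases n with
    | zero => simp [shiftedLegendreP]
    | succ n =>
      have h1 : (2 * (1 - X) : ℝ[X]).natDegree ≤ 1 := by compute_degree
      have h2 := natDegree_derivative_le (shiftedLegendreP (n + 1))
      exact natDegree_mul_le.trans (by omega)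
  have hsplit : (1 - X) * (derivative (shiftedLegendreP n) * shiftedLegendreP m
      - shiftedLegendreP n * derivative (shiftedLegendreP m)) =
      (2 * (1 - X) * derivative (shiftedLegendreP n) - shiftedLegendreP n) * shiftedLegendreP m
        - derivative ((1 - X) * shiftedLegendreP n * shiftedLegendreP m) := by
    simp
    ring
  rw [hsplit, map_sub, unitIntegral_mul_shiftedLegendreP hdeg, unitIntegral_derivative]
  simp [eval_zero_shiftedLegendreP, pow_add]

theorem N_comm (n m : ℕ) : N n m = N m n := by
  simp only [N, mul_comm (legendreP n _)]

theorem N_of_lt {n m : ℕ} (h : n < m) :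
    N n m = (-1 : ℝ) ^ (n + m + 1) / (((m : ℝ) - n) * ((n : ℝ) + m + 1)) := by
  have hpos : (0 : ℝ) < (m : ℝ) - n := sub_pos.mpr (by exact_mod_cast h)
  have key := integral_derivative_X_mul_mul_log
    ((1 - X) * (derivative (shiftedLegendreP n) * shiftedLegendreP m
      - shiftedLegendreP n * derivative (shiftedLegendreP m)))
  have hder : derivative (X * ((1 - X) * (derivative (shiftedLegendreP n) * shiftedLegendreP m
      - shiftedLegendreP n * derivative (shiftedLegendreP m)))) =
      C (((m : ℝ) - n) * ((n : ℝ) + m + 1)) * (shiftedLegendreP n * shiftedLegendreP m) := by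
    have hn := derivative_mul_derivative_shiftedLegendreP n
    have hm := derivative_mul_derivative_shiftedLegendreP m
    simp [-derivative_mul] at hn hm ⊢
    rw [derivative_mul] at hn hm
    have hW : X * ((1 - X) * (derivative (shiftedLegendreP n) * shiftedLegendreP m
        - shiftedLegendreP n * derivative (shiftedLegendreP m))) =
        shiftedLegendreP n * (X * (X - 1) * derivative (shiftedLegendreP m))
        - X * (X - 1) * derivative (shiftedLegendreP n) * shiftedLegendreP m := by ring
    rw [hW]
    simp only [derivative_sub, derivative_mul, derivative_X, derivative_one] at hn hm ⊢
    linear_combination shiftedLegendreP n * hm - shiftedLegendreP m * hn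
  rw [unitIntegral_wronskian_shiftedLegendreP h, hder] at key
  simp only [eval_mul, eval_C, eval_shiftedLegendreP, mul_assoc _ (_ * _) (Real.log _),
    intervalIntegral.integral_const_mul] at key
  rw [eq_div_iff (by positivity), N, mul_comm, key]
  ring

theorem stmt_1 (n m : ℕ) (h : n ≠ m) :
    N n m = (-1 : ℝ) ^ (n + m + 1) / (|(n : ℝ) - m| * ((n : ℝ) + m + 1)) := by
  rcases lt_or_gt_of_ne h with h | h
  · rw [N_of_lt h, abs_sub_comm, abs_of_pos (sub_pos.mpr (by exact_mod_cast h))]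
  · rw [N_comm, N_of_lt h, abs_of_pos (sub_pos.mpr (by exact_mod_cast h)),
      add_comm m n, add_comm (m : ℝ) n]
end

section
/- For every natural number n ≥ 1, the integral ∫₀¹ Pₙ(2x−1)·log(x) dx equals (−1)^(n+1) / (n·(n+1)). -/
open MeasureTheory Real

/-- The derivative of the Legendre polynomial `legendreP n`, given by the recurrence
`D (n+1) x = x * D n x + (n+1) * P n x`. -/
noncomputable def legendrePDeriv : ℕ → ℝ → ℝ
  | 0, _ => 0
  | (n + 1), x => x * legendrePDeriv n x + (n + 1 : ℝ) * legendreP n x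

lemma legendreP_add_two (n : ℕ) (x : ℝ) :
    ((n : ℝ) + 2) * legendreP (n + 2) x =
      (2 * (n : ℝ) + 3) * x * legendreP (n + 1) x - ((n : ℝ) + 1) * legendreP n x := by
  have h : (n : ℝ) + 1 + 1 ≠ 0 := by positivity
  rw [legendreP]
  field_simp
  ring

lemma mul_legendrePDeriv_succ_sub (n : ℕ) (x : ℝ) :
    x * legendrePDeriv (n + 1) x - legendrePDeriv n x = ((n : ℝ) + 1) * legendreP (n + 1) x := by
  induction n with
  | zero => simp [legendrePDeriv, legendreP]
  | succ n ih =>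
    have h₁ : legendrePDeriv (n + 1) x = x * legendrePDeriv n x + (n + 1 : ℝ) * legendreP n x := rfl
    have h₂ : legendrePDeriv (n + 2) x =
        x * legendrePDeriv (n + 1) x + ((n + 1 : ℕ) + 1 : ℝ) * legendreP (n + 1) x := rfl
    have h₃ := legendreP_add_two n x
    push_cast at h₂ ⊢
    linear_combination x * h₂ - h₁ - h₃ + x * ih

lemma one_sub_sq_mul_legendrePDeriv_succ (n : ℕ) (x : ℝ) :
    (1 - x ^ 2) * legendrePDeriv (n + 1) x =
      ((n : ℝ) + 1) * (legendreP n x - x * legendreP (n + 1) x) := by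
  have h₁ : legendrePDeriv (n + 1) x = x * legendrePDeriv n x + (n + 1 : ℝ) * legendreP n x := rfl
  linear_combination h₁ - x * mul_legendrePDeriv_succ_sub n x

lemma hasDerivAt_legendreP (n : ℕ) (x : ℝ) :
    HasDerivAt (legendreP n) (legendrePDeriv n x) x := by
  induction n using Nat.twoStepInduction with
  | zero =>
    have : legendreP 0 = fun _ => 1 := by funext y; simp [legendreP]
    simpa [this, legendrePDeriv] using hasDerivAt_const x (1 : ℝ)
  | one =>
    have : legendreP 1 = fun y => y := by funext y; simp [legendreP]
    simpa [this, legendrePDeriv, legendreP] using hasDerivAt_id' x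
  | more n ih₀ ih₁ =>
    have h : legendreP (n + 2) = fun y => ((2 * (n + 1 : ℝ) + 1) * y * legendreP (n + 1) y
        - (n + 1 : ℝ) * legendreP n y) / ((n + 1 : ℝ) + 1) := by funext y; rw [legendreP]
    rw [h]
    refine (((((hasDerivAt_id' x).const_mul (2 * (n + 1 : ℝ) + 1)).mul ih₁).sub
      (ih₀.const_mul (n + 1 : ℝ))).div_const ((n + 1 : ℝ) + 1)).congr_deriv ?_
    have hn : (n : ℝ) + 1 + 1 ≠ 0 := by positivity
    have h₂ : legendrePDeriv (n + 2) x =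
        x * legendrePDeriv (n + 1) x + ((n + 1 : ℕ) + 1 : ℝ) * legendreP (n + 1) x := rfl
    rw [div_eq_iff hn, h₂]
    push_cast
    linear_combination ((n : ℝ) + 1) * mul_legendrePDeriv_succ_sub n x

lemma continuous_legendreP (n : ℕ) : Continuous (legendreP n) :=
  continuous_iff_continuousAt.2 fun x => (hasDerivAt_legendreP n x).continuousAt

lemma continuous_legendrePDeriv (n : ℕ) : Continuous (legendrePDeriv n) := by
  induction n with
  | zero => exact continuous_const
  | succ n ih => exact (continuous_id.mul ih).add (continuous_const.mul (continuous_legendreP n))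

lemma legendreP_neg_one (n : ℕ) : legendreP n (-1) = (-1) ^ n := by
  induction n using Nat.twoStepInduction with
  | zero => simp [legendreP]
  | one => simp [legendreP]
  | more n ih₀ ih₁ =>
    have h := legendreP_add_two n (-1)
    have hn : (n : ℝ) + 2 ≠ 0 := by positivity
    refine mul_left_cancel₀ hn ?_
    rw [h, ih₀, ih₁]
    ring

/-- The Legendre differential equation: the derivative of `(1 - x²) D (n+1) x`, where `D (n+1)` is
the derivative of `P (n+1)`, is `-(n+1) (n+2) P (n+1) x`. -/
lemma hasDerivAt_one_sub_sq_mul_legendrePDeriv (n : ℕ) (x : ℝ) :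
    HasDerivAt (fun y => (1 - y ^ 2) * legendrePDeriv (n + 1) y)
      (-(((n : ℝ) + 1) * ((n : ℝ) + 2) * legendreP (n + 1) x)) x := by
  simp_rw [one_sub_sq_mul_legendrePDeriv_succ]
  refine (((hasDerivAt_legendreP n x).sub ((hasDerivAt_id' x).mul
    (hasDerivAt_legendreP (n + 1) x))).const_mul ((n : ℝ) + 1)).congr_deriv ?_
  linear_combination (-((n : ℝ) + 1)) * mul_legendrePDeriv_succ_sub n x

/-- An antiderivative of `(n+1) (n+2) P (n+1) (2x-1) log x`. -/
lemma hasDerivAt_legendreP_mul_log (n : ℕ) {x : ℝ} (hx : x ≠ 0) :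
    HasDerivAt (fun y => (1 - y) * legendreP (n + 1) (2 * y - 1)
        - (1 - (2 * y - 1) ^ 2) * legendrePDeriv (n + 1) (2 * y - 1) / 2
          * (log y + 1 / (((n : ℝ) + 1) * ((n : ℝ) + 2))))
      (((n : ℝ) + 1) * ((n : ℝ) + 2) * (legendreP (n + 1) (2 * x - 1) * log x)) x := by
  have ht : HasDerivAt (fun y : ℝ => 2 * y - 1) 2 x := by
    simpa using ((hasDerivAt_id' x).const_mul (2 : ℝ)).sub_const 1
  have hP := (hasDerivAt_legendreP (n + 1) (2 * x - 1)).comp x ht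
  have hQ := (hasDerivAt_one_sub_sq_mul_legendrePDeriv n (2 * x - 1)).comp x ht
  refine ((((hasDerivAt_id' x).const_sub 1).mul hP).sub ((hQ.div_const 2).mul
    ((hasDerivAt_log hx).add_const (1 / (((n : ℝ) + 1) * ((n : ℝ) + 2)))))).congr_deriv ?_
  have h₁ : (n : ℝ) + 1 ≠ 0 := by positivity
  have h₂ : (n : ℝ) + 2 ≠ 0 := by positivity
  simp only [Function.comp_apply]
  field_simp
  ring

lemma integral_legendreP_succ_mul_log (n : ℕ) :
    ∫ x in (0 : ℝ)..1, ((n : ℝ) + 1) * ((n : ℝ) + 2) * (legendreP (n + 1) (2 * x - 1) * log x) =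
      (-1) ^ n := by
  have hP : Continuous fun x : ℝ => legendreP (n + 1) (2 * x - 1) :=
    (continuous_legendreP _).comp (by fun_prop)
  have hD : Continuous fun x : ℝ => legendrePDeriv (n + 1) (2 * x - 1) :=
    (continuous_legendrePDeriv _).comp (by fun_prop)
  have hlog : Continuous fun x : ℝ => x * log x := continuous_mul_log
  rw [intervalIntegral.integral_eq_sub_of_hasDerivAt_of_le zero_le_one ?_
    (fun x hx => hasDerivAt_legendreP_mul_log n hx.1.ne') ?_]
  · norm_num [legendreP_neg_one, pow_succ]
  · have h : (fun y : ℝ => (1 - y) * legendreP (n + 1) (2 * y - 1)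
        - (1 - (2 * y - 1) ^ 2) * legendrePDeriv (n + 1) (2 * y - 1) / 2
          * (log y + 1 / (((n : ℝ) + 1) * ((n : ℝ) + 2)))) =
        fun y => (1 - y) * legendreP (n + 1) (2 * y - 1)
          - 2 * (1 - y) * legendrePDeriv (n + 1) (2 * y - 1)
            * (y * log y + y * (1 / (((n : ℝ) + 1) * ((n : ℝ) + 2)))) := by
      funext y
      ring
    rw [h]
    exact Continuous.continuousOn (by fun_prop)
  · exact (intervalIntegral.intervalIntegrable_log'.continuousOn_mul hP.continuousOn).const_mul _

theorem stmt_6 (n : ℕ) (h : 1 ≤ n) :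
    (∫ x in (0:ℝ)..1, legendreP n (2 * x - 1) * Real.log x) =
      (-1 : ℝ) ^ (n + 1) / ((n : ℝ) * ((n : ℝ) + 1)) := by
  obtain ⟨n, rfl⟩ := Nat.exists_eq_add_of_le' h
  have key := integral_legendreP_succ_mul_log n
  rw [intervalIntegral.integral_const_mul] at key
  have hn : ((n + 1 : ℕ) : ℝ) * (((n + 1 : ℕ) : ℝ) + 1) ≠ 0 := by positivity
  rw [eq_div_iff hn]
  push_cast
  linear_combination key
end
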